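/- Fix an integer k ≥ 2. For each dimension d ≥ 2, let X₁, …, X_k be independent random vectors, each distributed uniformly on the unit sphere S^{d-1} ⊂ ℝ^d, and let P_d := Prob(‖X₁ + X₂ + ⋯ + X_k‖ ≤ 1). Then lim_{d→∞} (2/d)·log P_d = (k−1)·log(k+1) − k·log k, i.e., P_d = ((k+1)^{k−1}/k^k)^{d/2 + o(d)}. (Equivalently, an input list of n uniformly random unit vectors contains roughly n good k-tuples precisely when n ≥ (k^{k/(k−1)}/(k+1))^{d/2+o(d)}, the list size bound for k-tuple sieving.) -/

import Mathlib

open MeasureTheory Filter Real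

/-- The uniform (normalized surface) probability measure on the unit sphere
`S^{d-1} ⊂ ℝ^d`. -/
noncomputable def sphereUniform (d : ℕ) :
    Measure (Metric.sphere (0 : EuclideanSpace ℝ (Fin d)) 1) :=
  ((volume : Measure (EuclideanSpace ℝ (Fin d))).toSphere Set.univ)⁻¹ •
    (volume : Measure (EuclideanSpace ℝ (Fin d))).toSphere

/-- The probability that `k` independent uniformly random points on `S^{d-1}`
form a good tuple, i.e. have sum of norm at most `1`. -/
noncomputable def goodTupleProb (k d : ℕ) : ℝ :=
  ((Measure.pi fun _ : Fin k => sphereUniform d)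
    {x : Fin k → Metric.sphere (0 : EuclideanSpace ℝ (Fin d)) 1 |
      ‖∑ i, (x i : EuclideanSpace ℝ (Fin d))‖ ≤ 1}).toReal


/-! ### Basic facts on the uniform measure -/

abbrev EE (d : ℕ) := EuclideanSpace ℝ (Fin d)

noncomputable def om (d : ℕ) : ENNReal := (volume : Measure (EE d)) (Metric.ball 0 1)

lemma om_ne_zero (d : ℕ) : om d ≠ 0 := (Metric.measure_ball_pos _ _ one_pos).ne'

lemma om_ne_top (d : ℕ) : om d ≠ ⊤ := measure_ball_lt_top.ne

lemma toSphere_univ_eq (d : ℕ) :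
    (volume : Measure (EE d)).toSphere Set.univ = d * om d := by
  rw [Measure.toSphere_apply_univ]; simp [om]

lemma sphereUniform_isProb {d : ℕ} (hd : 0 < d) : IsProbabilityMeasure (sphereUniform d) := by
  constructor
  rw [sphereUniform, Measure.smul_apply, smul_eq_mul]
  apply ENNReal.inv_mul_cancel
  · rw [toSphere_univ_eq]
    exact mul_ne_zero (by exact_mod_cast hd.ne') (om_ne_zero d)
  · rw [toSphere_univ_eq]
    exact ENNReal.mul_ne_top (by simp) (om_ne_top d)

open scoped Pointwise in
lemma sphereUniform_apply {d : ℕ} (hd : 0 < d) {s : Set (Metric.sphere (0 : EE d) 1)}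
    (hs : MeasurableSet s) :
    sphereUniform d s = volume (Set.Ioo (0 : ℝ) 1 • ((↑) '' s : Set (EE d))) / om d := by
  rw [sphereUniform, Measure.smul_apply, smul_eq_mul, toSphere_univ_eq,
    Measure.toSphere_apply' _ hs]
  simp only [finrank_euclideanSpace, Fintype.card_fin]
  rw [mul_comm, ← div_eq_mul_inv, ENNReal.mul_div_mul_left]
  · exact_mod_cast hd.ne'
  · simp

/-- Iterated expectation. -/
noncomputable def JJ (d n : ℕ) (f : EE d → ENNReal) (u : EE d) : ENNReal :=
  ∫⁻ x : Fin n → Metric.sphere (0 : EE d) 1, f (u + ∑ i, (x i : EE d))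
    ∂(Measure.pi fun _ : Fin n => sphereUniform d)

lemma JJ_zero (d : ℕ) (f : EE d → ENNReal) (u : EE d) : JJ d 0 f u = f u := by
  simp [JJ]

lemma JJ_succ {d : ℕ} (hd : 0 < d) (n : ℕ) {f : EE d → ENNReal} (hf : Measurable f) (u : EE d) :
    JJ d (n + 1) f u = ∫⁻ x, JJ d n f (u + (x : EE d)) ∂(sphereUniform d) := by
  have := sphereUniform_isProb hd
  have h := measurePreserving_piFinSuccAbove (fun _ : Fin (n + 1) => sphereUniform d) 0
  have hm : Measurable (fun p : Metric.sphere (0 : EE d) 1 × (Fin n → Metric.sphere (0 : EE d) 1) =>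
      f (u + p.1 + ∑ i, (p.2 i : EE d))) := by
    apply hf.comp
    fun_prop
  unfold JJ
  rw [← lintegral_prod (μ := sphereUniform d) _ hm.aemeasurable, ← h.lintegral_comp hm]
  congr 1
  ext x
  simp [Fin.sum_univ_succ, add_assoc, MeasurableEquiv.piFinSuccAbove, Fin.tail]

lemma goodTupleProb_eq (k d : ℕ) :
    goodTupleProb k d =
      (JJ d k (Set.indicator {u : EE d | ‖u‖ ≤ 1} (fun _ => 1)) 0).toReal := by
  unfold goodTupleProb JJ
  congr 1
  rw [← lintegral_indicator_one]
  · congr 1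
    ext x
    simp [Set.indicator]
  · apply measurableSet_le
    · fun_prop
    · fun_prop

/-! ### Gamma bound -/

lemma Gamma_upper {x : ℝ} (hx : 0 < x) :
    Real.Gamma (x + 1) ≤ (x + 1) * Real.exp 1 * (x / Real.exp 1) ^ x := by
  have hx1 : 0 < x + 1 := by linarith
  rw [Real.Gamma_eq_integral hx1]
  have key : ∀ t : ℝ, 0 < t → Real.exp (-t) * t ^ (x + 1 - 1) ≤
      ((x + 1) / Real.exp 1) ^ x * Real.exp (-(1 / (x + 1)) * t) := by
    intro t ht
    rw [add_sub_cancel_right, Real.rpow_def_of_pos ht, Real.rpow_def_of_pos (by positivity),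
      ← Real.exp_add, ← Real.exp_add, Real.exp_le_exp, Real.log_div hx1.ne' (Real.exp_ne_zero _),
      Real.log_exp]
    have h1 := Real.log_le_sub_one_of_pos (div_pos ht hx1)
    rw [Real.log_div ht.ne' hx1.ne'] at h1
    have h2 := mul_le_mul_of_nonneg_right h1 hx.le
    have h3 : t / (x + 1) * x = t - 1 / (x + 1) * t := by field_simp; ring
    nlinarith
  have hint : IntegrableOn (fun t : ℝ => ((x + 1) / Real.exp 1) ^ x *
      Real.exp (-(1 / (x + 1)) * t)) (Set.Ioi 0) :=
    ((exp_neg_integrableOn_Ioi 0 (by positivity : 0 < 1 / (x + 1)))).const_mul _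
  have h1 : ∫ t in Set.Ioi (0:ℝ), Real.exp (-t) * t ^ (x + 1 - 1) ≤
      ∫ t in Set.Ioi (0:ℝ), ((x + 1) / Real.exp 1) ^ x * Real.exp (-(1 / (x + 1)) * t) :=
    setIntegral_mono_on (Real.GammaIntegral_convergent hx1) hint measurableSet_Ioi
      (fun t ht => key t ht)
  refine h1.trans ?_
  rw [integral_const_mul, integral_exp_mul_Ioi (by simp; positivity)]
  simp only [mul_zero, Real.exp_zero]
  have h2 : -1 / -(1 / (x + 1)) = x + 1 := by field_simp
  rw [h2]
  have h3 : ((x + 1) / Real.exp 1) ^ x ≤ Real.exp 1 * (x / Real.exp 1) ^ x := by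
    rw [Real.rpow_def_of_pos (by positivity), Real.rpow_def_of_pos (by positivity),
      ← Real.exp_add, Real.exp_le_exp, Real.log_div hx1.ne' (Real.exp_ne_zero _),
      Real.log_div hx.ne' (Real.exp_ne_zero _)]
    have h4 := Real.log_le_sub_one_of_pos (div_pos hx1 hx)
    rw [Real.log_div hx1.ne' hx.ne'] at h4
    have h5 := mul_le_mul_of_nonneg_right h4 hx.le
    have h6 : ((x + 1) / x - 1) * x = 1 := by field_simp; ring
    nlinarith
  nlinarith

/-- lower bound for the volume of the unit ball -/
lemma om_lower {d : ℕ} (hd : 0 < d) :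
    ENNReal.ofReal ((2 * π * Real.exp 1 / d) ^ ((d : ℝ) / 2) / (((d : ℝ) / 2 + 1) * Real.exp 1))
      ≤ om d := by
  have : Nonempty (Fin d) := ⟨⟨0, hd⟩⟩
  have hd' : (0 : ℝ) < d := by exact_mod_cast hd
  unfold om
  rw [EuclideanSpace.volume_ball]
  simp only [Fintype.card_fin, ENNReal.ofReal_one, one_pow, one_mul]
  apply ENNReal.ofReal_le_ofReal
  have h := Gamma_upper (x := (d : ℝ) / 2) (by positivity)
  have hG : 0 < Real.Gamma ((d : ℝ) / 2 + 1) := Real.Gamma_pos_of_pos (by positivity)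
  have hs : √π ^ d = π ^ ((d : ℝ) / 2) := by
    rw [Real.sqrt_eq_rpow, ← Real.rpow_natCast, ← Real.rpow_mul pi_pos.le]
    congr 1; ring
  rw [hs, div_le_div_iff₀ (by positivity) hG]
  have e : (2 * π * Real.exp 1 / d) ^ ((d : ℝ) / 2) * ((d : ℝ) / 2 / Real.exp 1) ^ ((d : ℝ) / 2)
      = π ^ ((d : ℝ) / 2) := by
    rw [← Real.mul_rpow (by positivity) (by positivity)]
    congr 1
    field_simp
  calc _ ≤ (2 * π * Real.exp 1 / d) ^ ((d : ℝ) / 2) * (((d : ℝ) / 2 + 1) * Real.exp 1 *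
        ((d : ℝ) / 2 / Real.exp 1) ^ ((d : ℝ) / 2)) := by gcongr
    _ = ((2 * π * Real.exp 1 / d) ^ ((d : ℝ) / 2) * ((d : ℝ) / 2 / Real.exp 1) ^ ((d : ℝ) / 2)) *
        (((d : ℝ) / 2 + 1) * Real.exp 1) := by ring
    _ = _ := by rw [e]

/-! ### Upper bound -/

lemma volumeIoiPow_shell {d : ℕ} (hd : 2 ≤ d) :
    ∃ S : Set (Set.Ioi (0 : ℝ)), MeasurableSet S ∧
      (∀ r ∈ S, 1 - 1 / (d : ℝ) ≤ r.1 ∧ r.1 < 1) ∧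
      ENNReal.ofReal (1 / (2 * d)) ≤ Measure.volumeIoiPow (d - 1) S := by
  have hd' : (2 : ℝ) ≤ d := by exact_mod_cast hd
  have h0 : (0 : ℝ) < 1 - 1 / d := by
    have : 1 / (d : ℝ) ≤ 1 / 2 := by gcongr
    linarith
  refine ⟨Set.Iio ⟨1, Set.mem_Ioi.2 one_pos⟩ \ Set.Iio ⟨1 - 1 / d, h0⟩, by measurability, ?_, ?_⟩
  · rintro r ⟨h1, h2⟩
    simp only [Set.mem_Iio, not_lt] at h1 h2
    exact ⟨h2, h1⟩
  · refine le_trans ?_ le_measure_sdiff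
    rw [Measure.volumeIoiPow_apply_Iio, Measure.volumeIoiPow_apply_Iio,
      ← ENNReal.ofReal_sub _ (by positivity)]
    apply ENNReal.ofReal_le_ofReal
    have h1 : ((d - 1 : ℕ) : ℝ) + 1 = d := by
      rw [Nat.cast_sub (by omega)]; simp
    have h2 : d - 1 + 1 = d := by omega
    rw [h1, h2]
    have h3 : (1 - 1 / (d : ℝ)) ^ d ≤ Real.exp (-1) := Real.one_sub_div_pow_le_exp_neg (by linarith)
    have h4 : Real.exp (-1) ≤ 1 / 2 := by
      rw [Real.exp_neg, ← one_div]
      have := Real.add_one_le_exp (1 : ℝ)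
      gcongr; linarith
    simp only [one_pow]
    rw [← sub_div, ← div_div]
    gcongr
    linarith

lemma polar_lower {d : ℕ} (hd : 2 ≤ d) {F : EE d → ENNReal} (hF : Measurable F)
    {G : Metric.sphere (0 : EE d) 1 → ENNReal}
    (h : ∀ x, ∀ r : ℝ, 1 - 1 / (d : ℝ) ≤ r → 0 < r → r < 1 → G x ≤ F (r • (x : EE d))) :
    om d * ENNReal.ofReal (1 / 2) * ∫⁻ x, G x ∂(sphereUniform d) ≤ ∫⁻ y, F y := by
  obtain ⟨S, hSm, hS, hSv⟩ := volumeIoiPow_shell hd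
  have hd0 : (d : ENNReal) ≠ 0 := by exact_mod_cast (by omega : d ≠ 0)
  have hfin : Module.finrank ℝ (EE d) = d := by simp
  have e1 : ∫⁻ y, F y = ∫⁻ p : Metric.sphere (0 : EE d) 1 × Set.Ioi (0 : ℝ),
      F (p.2.1 • (p.1 : EE d)) ∂((volume : Measure (EE d)).toSphere.prod
        (Measure.volumeIoiPow (d - 1))) := by
    have hmp := (volume : Measure (EE d)).measurePreserving_homeomorphUnitSphereProd
    rw [hfin] at hmp
    rw [← hmp.lintegral_comp_emb (Homeomorph.measurableEmbedding _)]
    have : ∀ y : ({0}ᶜ : Set (EE d)), F (((homeomorphUnitSphereProd (EE d)) y).2.1 •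
        (((homeomorphUnitSphereProd (EE d)) y).1 : EE d)) = F y := by
      intro y
      congr 1
      have hy : ‖(y : EE d)‖ ≠ 0 := norm_ne_zero_iff.2 y.2
      simp [smul_smul, hy]
    simp_rw [this]
    rw [lintegral_subtype_comap (measurableSet_singleton _).compl]
    have : Nontrivial (EE d) := by
      have : Nonempty (Fin d) := ⟨⟨0, by omega⟩⟩
      infer_instance
    rw [Measure.restrict_eq_self_of_ae_mem]
    exact compl_mem_ae_iff.2 (measure_singleton _)
  rw [e1, lintegral_prod _ (by
    apply Measurable.aemeasurable
    apply hF.comp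
    fun_prop)]
  have e2 : ∀ x : Metric.sphere (0 : EE d) 1, ENNReal.ofReal (1 / (2 * d)) * G x ≤
      ∫⁻ r, F (r.1 • (x : EE d)) ∂(Measure.volumeIoiPow (d - 1)) := by
    intro x
    calc ENNReal.ofReal (1 / (2 * d)) * G x ≤ G x * Measure.volumeIoiPow (d - 1) S := by
          rw [mul_comm]; gcongr
      _ = ∫⁻ r in S, G x ∂(Measure.volumeIoiPow (d - 1)) := by rw [setLIntegral_const]
      _ ≤ ∫⁻ r in S, F (r.1 • (x : EE d)) ∂(Measure.volumeIoiPow (d - 1)) := by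
          apply setLIntegral_mono' hSm
          intro r hr
          exact h x r.1 (hS r hr).1 r.2 (hS r hr).2
      _ ≤ _ := setLIntegral_le_lintegral _ _
  refine le_trans ?_ (lintegral_mono e2)
  rw [lintegral_const_mul' _ _ ENNReal.ofReal_ne_top, sphereUniform, lintegral_smul_measure,
    toSphere_univ_eq, smul_eq_mul, ← mul_assoc]
  apply le_of_eq
  congr 1
  rw [ENNReal.mul_inv (by left; exact hd0) (by left; simp), one_div, one_div, mul_inv,
    ENNReal.ofReal_mul (by positivity)]
  have : ENNReal.ofReal ((d : ℝ)⁻¹) = (d : ENNReal)⁻¹ := by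
    rw [ENNReal.ofReal_inv_of_pos (by exact_mod_cast (by omega : 0 < d)), ENNReal.ofReal_natCast]
  rw [this]
  calc om d * ENNReal.ofReal 2⁻¹ * ((d : ENNReal)⁻¹ * (om d)⁻¹)
      = (om d * (om d)⁻¹) * (ENNReal.ofReal 2⁻¹ * (d : ENNReal)⁻¹) := by ring
    _ = _ := by rw [ENNReal.mul_inv_cancel (om_ne_zero d) (om_ne_top d), one_mul]

lemma gauss_shift {d : ℕ} {a b : ℝ} (ha : 0 < a) (hb : 0 < b) (u : EE d) :
    ∫⁻ y : EE d, ENNReal.ofReal (Real.exp (-a * ‖y‖ ^ 2 - b * ‖u + y‖ ^ 2)) =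
      ENNReal.ofReal (Real.exp (-(a * b / (a + b)) * ‖u‖ ^ 2) * (π / (a + b)) ^ ((d : ℝ) / 2)) := by
  have hab : 0 < a + b := by linarith
  have e : ∀ y : EE d, Real.exp (-a * ‖y‖ ^ 2 - b * ‖u + y‖ ^ 2) =
      Real.exp (-(a * b / (a + b)) * ‖u‖ ^ 2) *
        Real.exp (-(a + b) * ‖y + (b / (a + b)) • u‖ ^ 2) := by
    intro y
    rw [← Real.exp_add, norm_add_sq_real, norm_add_sq_real, norm_smul, real_inner_smul_right,
      Real.norm_of_nonneg (by positivity), real_inner_comm y u]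
    congr 1
    field_simp
    ring
  have h0 := GaussianFourier.integral_rexp_neg_mul_sq_norm (V := EE d) hab
  have hint : Integrable (fun v : EE d => Real.exp (-(a + b) * ‖v‖ ^ 2)) := by
    by_contra hcon
    rw [integral_undef hcon] at h0
    have : (0 : ℝ) < (π / (a + b)) ^ ((Module.finrank ℝ (EE d) : ℝ) / 2) := by positivity
    linarith
  simp_rw [e]
  simp_rw [ENNReal.ofReal_mul (Real.exp_pos _).le]
  rw [lintegral_const_mul' _ _ ENNReal.ofReal_ne_top]
  congr 1
  rw [lintegral_add_right_eq_self
    (fun y : EE d => ENNReal.ofReal (Real.exp (-(a + b) * ‖y‖ ^ 2))),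
    ← ofReal_integral_eq_lintegral_ofReal hint (Filter.Eventually.of_forall fun _ => (Real.exp_pos _).le), h0]
  simp

lemma step_upper {d : ℕ} (hd : 2 ≤ d) {K α β : ℝ} (hα : 0 < α) (hβ : 0 < β) (u : EE d)
    (hu : ‖u‖ ≤ K) :
    ∫⁻ x, ENNReal.ofReal (Real.exp (-β * (d / 2) * ‖u + (x : EE d)‖ ^ 2)) ∂(sphereUniform d) ≤
      ENNReal.ofReal ((2 * Real.exp (β * (2 * K + 3) / 2) * (((d : ℝ) / 2 + 1) * Real.exp 1)) *
        (Real.exp (α - 1) / (α + β)) ^ ((d : ℝ) / 2) *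
        Real.exp (-(α * β / (α + β)) * (d / 2) * ‖u‖ ^ 2)) := by
  have hd' : (2 : ℝ) ≤ d := by exact_mod_cast hd
  have hd0 : (0 : ℝ) < d := by linarith
  set w : ℝ := (2 * π * Real.exp 1 / d) ^ ((d : ℝ) / 2) / (((d : ℝ) / 2 + 1) * Real.exp 1) with hw
  have hw0 : 0 < w := by positivity
  set c : ℝ := Real.exp (-(α * (d / 2)) - β * (2 * K + 3) / 2) with hc
  have hF : Measurable (fun y : EE d => ENNReal.ofReal (Real.exp (-(α * (d / 2)) * ‖y‖ ^ 2
      - (β * (d / 2)) * ‖u + y‖ ^ 2))) := by fun_prop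
  have hp := polar_lower hd hF (G := fun x => ENNReal.ofReal c *
    ENNReal.ofReal (Real.exp (-β * (d / 2) * ‖u + (x : EE d)‖ ^ 2))) (by
      intro x r h1 h2 h3
      rw [← ENNReal.ofReal_mul (Real.exp_pos _).le, ← Real.exp_add]
      apply ENNReal.ofReal_le_ofReal
      rw [Real.exp_le_exp]
      have hx : ‖(x : EE d)‖ = 1 := by simp
      have n1 : ‖r • (x : EE d)‖ = r := by rw [norm_smul, hx, Real.norm_of_nonneg h2.le, mul_one]
      have n2 : ‖u + r • (x : EE d)‖ ≤ ‖u + (x : EE d)‖ + 1 / d := by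
        have : u + r • (x : EE d) = (u + x) - (1 - r) • (x : EE d) := by
          rw [sub_smul, one_smul]; abel
        rw [this]
        refine (norm_sub_le _ _).trans ?_
        rw [norm_smul, hx, Real.norm_of_nonneg (by linarith)]
        linarith
      have n3 : ‖u + (x : EE d)‖ ≤ K + 1 := by
        refine (norm_add_le _ _).trans ?_
        rw [hx]; linarith
      have n4 : ‖u + r • (x : EE d)‖ ^ 2 ≤ ‖u + (x : EE d)‖ ^ 2 + (2 * K + 3) / d := by
        have hd1 : 1 / (d : ℝ) ≤ 1 := by rw [div_le_one hd0]; linarith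
        have hd2 : 0 < 1 / (d : ℝ) := by positivity
        calc ‖u + r • (x : EE d)‖ ^ 2 ≤ (‖u + (x : EE d)‖ + 1 / d) ^ 2 := by gcongr
          _ = ‖u + (x : EE d)‖ ^ 2 + (2 * ‖u + (x : EE d)‖ + 1 / d) * (1 / d) := by ring
          _ ≤ ‖u + (x : EE d)‖ ^ 2 + (2 * K + 3) * (1 / d) := by
              have : 2 * ‖u + (x : EE d)‖ + 1 / d ≤ 2 * K + 3 := by linarith
              gcongr
          _ = _ := by ring
      have n5 := mul_le_mul_of_nonneg_left n4 (by positivity : 0 ≤ β * ((d : ℝ) / 2))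
      have n6 : β * ((d : ℝ) / 2) * ((2 * K + 3) / d) = β * (2 * K + 3) / 2 := by field_simp
      have n7 : α * ((d : ℝ) / 2) * r ^ 2 ≤ α * ((d : ℝ) / 2) * 1 := by
        gcongr; nlinarith
      rw [n1]
      linarith)
  rw [lintegral_const_mul' _ _ ENNReal.ofReal_ne_top,
    gauss_shift (by positivity) (by positivity)] at hp
  set I := ∫⁻ x, ENNReal.ofReal (Real.exp (-β * (d / 2) * ‖u + (x : EE d)‖ ^ 2))
    ∂(sphereUniform d) with hI
  have hom := om_lower (d := d) (by omega)
  rw [← hw] at hom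
  have hp2 : ENNReal.ofReal (w * (1 / 2) * c) * I ≤ _ := le_trans (by
    rw [ENNReal.ofReal_mul (by positivity), ENNReal.ofReal_mul (by positivity),
      mul_assoc (ENNReal.ofReal w * _)]
    gcongr) hp
  have hwc : 0 < w * (1 / 2) * c := by positivity
  rw [mul_comm, ← ENNReal.le_div_iff_mul_le (by left; simpa using hwc) (by left; simp),
    ← ENNReal.ofReal_div_of_pos hwc] at hp2
  refine hp2.trans (ENNReal.ofReal_le_ofReal (le_of_eq ?_))
  have q1 : α * ((d : ℝ) / 2) * (β * (d / 2)) / (α * (d / 2) + β * (d / 2)) =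
      α * β / (α + β) * (d / 2) := by field_simp
  rw [q1]
  have q2 : Real.exp (α - 1) / (α + β) = (π / (α * (d / 2) + β * (d / 2))) /
      (2 * π * Real.exp 1 / d) * Real.exp α := by
    rw [Real.exp_sub]; field_simp
  have q3 : (Real.exp (α - 1) / (α + β)) ^ ((d : ℝ) / 2) =
      (π / (α * (d / 2) + β * (d / 2))) ^ ((d : ℝ) / 2) /
      (2 * π * Real.exp 1 / d) ^ ((d : ℝ) / 2) * Real.exp (α * (d / 2)) := by
    rw [q2, Real.mul_rpow (by positivity) (by positivity),
      Real.div_rpow (x := π / (α * (d / 2) + β * (d / 2))) (by positivity) (by positivity),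
      ← Real.exp_mul]
  rw [q3, hw, hc, Real.exp_sub, Real.exp_neg]
  have z1 : (2 * π * Real.exp 1 / d) ^ ((d : ℝ) / 2) ≠ 0 := by positivity
  have z2 : Real.exp (α * (d / 2)) ≠ 0 := (Real.exp_pos _).ne'
  have z3 : Real.exp (β * (2 * K + 3) / 2) ≠ 0 := (Real.exp_pos _).ne'
  rw [show -(α * β / (α + β) * ((d : ℝ) / 2)) = -(α * β / (α + β)) * (d / 2) by ring]
  generalize (2 * π * Real.exp 1 / d) ^ ((d : ℝ) / 2) = Z1 at *
  generalize Real.exp (α * (d / 2)) = Z2 at *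
  generalize Real.exp (β * (2 * K + 3) / 2) = Z3 at *
  generalize Real.exp (-(α * β / (α + β)) * (d / 2) * ‖u‖ ^ 2) = Z4 at *
  generalize (π / (α * ((d : ℝ) / 2) + β * (d / 2))) ^ ((d : ℝ) / 2) = Z5 at *
  field_simp

lemma JJ_upper {d : ℕ} (hd : 2 ≤ d) {K α : ℝ} (hK : 0 ≤ K) (hα : 0 < α) (n : ℕ) :
    ∀ u : EE d, ‖u‖ + n ≤ K →
    JJ d n (fun v => ENNReal.ofReal (Real.exp (-α * (d / 2) * ‖v‖ ^ 2))) u ≤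
      ENNReal.ofReal ((2 * Real.exp (α * (2 * K + 3) / 2) * (((d : ℝ) / 2 + 1) * Real.exp 1)) ^ n *
        (Real.exp (n * (α - 1)) / (α ^ n * (n + 1))) ^ ((d : ℝ) / 2) *
        Real.exp (-(α / (n + 1)) * (d / 2) * ‖u‖ ^ 2)) := by
  induction n with
  | zero => intro u _; rw [JJ_zero]; simp
  | succ n ih =>
    intro u hu
    push_cast at hu
    rw [JJ_succ (by omega) n (by fun_prop)]
    have hβ : 0 < α / ((n : ℝ) + 1) := by positivity
    set B := 2 * Real.exp (α * (2 * K + 3) / 2) * (((d : ℝ) / 2 + 1) * Real.exp 1) with hB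
    have hB0 : 0 < B := by positivity
    set T := (Real.exp (n * (α - 1)) / (α ^ n * ((n : ℝ) + 1))) ^ ((d : ℝ) / 2) with hT
    have hT0 : 0 < T := by positivity
    have h1 : ∫⁻ x, JJ d n (fun v => ENNReal.ofReal (Real.exp (-α * (d / 2) * ‖v‖ ^ 2)))
        (u + (x : EE d)) ∂(sphereUniform d) ≤ ENNReal.ofReal (B ^ n * T) *
        ∫⁻ x, ENNReal.ofReal (Real.exp (-(α / (n + 1)) * (d / 2) * ‖u + (x : EE d)‖ ^ 2))
          ∂(sphereUniform d) := by
      rw [← lintegral_const_mul' _ _ ENNReal.ofReal_ne_top]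
      apply lintegral_mono
      intro x
      refine (ih (u + x) ?_).trans (le_of_eq ?_)
      · have := norm_add_le u (x : EE d)
        have hx : ‖(x : EE d)‖ = 1 := by simp
        linarith
      · exact ENNReal.ofReal_mul (by positivity)
    refine h1.trans ?_
    have h2 := step_upper hd (K := K) hα hβ u (by linarith [(Nat.cast_nonneg n : (0 : ℝ) ≤ n)])
    refine (mul_le_mul_right h2 _).trans ?_
    rw [← ENNReal.ofReal_mul (by positivity)]
    apply ENNReal.ofReal_le_ofReal
    have e1 : α * (α / ((n : ℝ) + 1)) / (α + α / (n + 1)) = α / (((n + 1 : ℕ) : ℝ) + 1) := by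
      push_cast; field_simp; try ring_nf
    have e2 : T * (Real.exp (α - 1) / (α + α / (n + 1))) ^ ((d : ℝ) / 2) =
        (Real.exp (((n + 1 : ℕ) : ℝ) * (α - 1)) / (α ^ (n + 1) * (((n + 1 : ℕ) : ℝ) + 1)))
          ^ ((d : ℝ) / 2) := by
      rw [hT, ← Real.mul_rpow (by positivity) (by positivity)]
      congr 1
      push_cast
      rw [add_mul, one_mul, Real.exp_add]
      field_simp
      try ring
    rw [e1, ← e2]
    have e3 : 2 * Real.exp (α / ((n : ℝ) + 1) * (2 * K + 3) / 2) * (((d : ℝ) / 2 + 1) * Real.exp 1)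
        ≤ B := by
      rw [hB]
      gcongr
      apply div_le_self hα.le
      have : (0 : ℝ) ≤ n := Nat.cast_nonneg n
      linarith
    set W := (Real.exp (α - 1) / (α + α / (n + 1))) ^ ((d : ℝ) / 2) with hW
    have hW0 : 0 < W := by positivity
    set X := Real.exp (-(α / (((n + 1 : ℕ) : ℝ) + 1)) * (d / 2) * ‖u‖ ^ 2) with hX
    have hX0 : 0 < X := Real.exp_pos _
    calc _ ≤ B ^ n * T * (B * W * X) := by gcongr
      _ = _ := by ring

noncomputable def QQ (k : ℕ) : ℝ := ((k : ℝ) + 1) ^ (k - 1) / (k : ℝ) ^ k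

lemma QQ_pos {k : ℕ} (hk : 2 ≤ k) : 0 < QQ k := by
  have : (0 : ℝ) < k := by exact_mod_cast (by omega : 0 < k)
  unfold QQ; positivity

lemma prob_upper {k : ℕ} (hk : 2 ≤ k) : ∃ C : ℝ, 0 < C ∧ ∀ d : ℕ, 2 ≤ d →
    goodTupleProb k d ≤ (C * ((d : ℝ) / 2 + 1)) ^ k * (QQ k) ^ ((d : ℝ) / 2) := by
  have hk0 : (0 : ℝ) < k := by exact_mod_cast (by omega : 0 < k)
  set α : ℝ := k / (k + 1) with hα
  have hα0 : 0 < α := by positivity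
  refine ⟨2 * Real.exp (α * (2 * k + 3) / 2) * Real.exp 1, by positivity, fun d hd => ?_⟩
  have hd0 : (0 : ℝ) < d := by exact_mod_cast (by omega : 0 < d)
  rw [goodTupleProb_eq]
  apply ENNReal.toReal_le_of_le_ofReal
  · have := QQ_pos hk
    positivity
  have h1 : JJ d k (Set.indicator {u : EE d | ‖u‖ ≤ 1} (fun _ => 1)) 0 ≤
      ENNReal.ofReal (Real.exp (α * (d / 2))) *
        JJ d k (fun v => ENNReal.ofReal (Real.exp (-α * (d / 2) * ‖v‖ ^ 2))) 0 := by
    unfold JJ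
    rw [← lintegral_const_mul' _ _ ENNReal.ofReal_ne_top]
    apply lintegral_mono
    intro x
    dsimp only
    rw [← ENNReal.ofReal_mul (Real.exp_pos _).le, ← Real.exp_add]
    by_cases hx : ‖(0 : EE d) + ∑ i, (x i : EE d)‖ ≤ 1
    · rw [Set.indicator_of_mem (by exact hx)]
      rw [← ENNReal.ofReal_one]
      apply ENNReal.ofReal_le_ofReal
      apply Real.one_le_exp
      have : ‖(0 : EE d) + ∑ i, (x i : EE d)‖ ^ 2 ≤ 1 := pow_le_one₀ (norm_nonneg _) hx
      have h2 := mul_le_mul_of_nonneg_left this (by positivity : 0 ≤ α * ((d : ℝ) / 2))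
      linarith
    · rw [Set.indicator_of_notMem (by exact hx)]
      exact zero_le
  have h2 := JJ_upper hd (K := k) hk0.le hα0 k (0 : EE d) (by simp)
  refine h1.trans ((mul_le_mul_right h2 _).trans ?_)
  rw [← ENNReal.ofReal_mul (Real.exp_pos _).le]
  apply ENNReal.ofReal_le_ofReal
  apply le_of_eq
  have e : QQ k = Real.exp α * (Real.exp (k * (α - 1)) / (α ^ k * ((k : ℝ) + 1))) := by
    rw [mul_div_assoc', ← Real.exp_add]
    have : α + k * (α - 1) = 0 := by rw [hα]; field_simp; ring
    rw [this, Real.exp_zero, QQ, hα, div_pow]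
    obtain ⟨m, rfl⟩ : ∃ m, k = m + 1 := ⟨k - 1, by omega⟩
    simp only [Nat.add_sub_cancel]
    field_simp
    ring
  rw [e, Real.mul_rpow (by positivity) (by positivity), ← Real.exp_mul]
  simp only [norm_zero]
  norm_num
  ring

/-! ### Lower bound -/

lemma vol_slab {d : ℕ} (hd : 0 < d) (u : EE d) {M ε r : ℝ} (hM : 0 < M) (hu : ‖u‖ ^ 2 ≤ M)
    (hε : 0 < ε) :
    volume {z : EE d | ‖z‖ < r ∧ ε ≤ inner ℝ u z} ≤
      ENNReal.ofReal (√(r ^ 2 - ε ^ 2 / M) ^ d) * om d := by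
  have : Nonempty (Fin d) := ⟨⟨0, hd⟩⟩
  have h : {z : EE d | ‖z‖ < r ∧ ε ≤ inner ℝ u z} ⊆
      Metric.closedBall ((ε / M) • u) (√(r ^ 2 - ε ^ 2 / M)) := by
    rintro z ⟨h1, h2⟩
    rw [mem_closedBall_iff_norm]
    apply Real.le_sqrt_of_sq_le
    rw [norm_sub_sq_real, real_inner_smul_right, norm_smul, mul_pow,
      Real.norm_of_nonneg (by positivity), real_inner_comm]
    have h3 : ‖z‖ ^ 2 ≤ r ^ 2 := by gcongr
    have h4 : ε / M * ε ≤ ε / M * inner ℝ u z := by gcongr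
    have h5 : (ε / M) ^ 2 * ‖u‖ ^ 2 ≤ (ε / M) ^ 2 * M := by gcongr
    have h6 : (ε / M) ^ 2 * M = ε ^ 2 / M := by field_simp
    have h7 : ε / M * ε = ε ^ 2 / M := by field_simp
    linarith
  refine (measure_mono h).trans (le_of_eq ?_)
  rw [Measure.addHaar_closedBall _ _ (Real.sqrt_nonneg _)]
  simp [om]

lemma pow_small {a r : ℝ} (ha : 0 ≤ a) (har : a < r) :
    ∀ᶠ d : ℕ in atTop, a ^ d ≤ r ^ d / 4 := by
  have hr : 0 < r := by linarith
  have h := tendsto_pow_atTop_nhds_zero_of_lt_one (r := a / r) (by positivity)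
    ((div_lt_one hr).2 har)
  filter_upwards [h.eventually (ge_mem_nhds (by norm_num : (0 : ℝ) < 1 / 4))] with d hd
  rw [div_pow, div_le_iff₀ (by positivity)] at hd
  linarith

lemma step_params {s t q δ' : ℝ} (hs : 0 ≤ s) (hq : 0 < q) (hq2 : q ^ 2 < 1 - t ^ 2 * s)
    (hδ' : 0 < δ') : ∃ r ε : ℝ, q < r ∧ 0 < ε ∧ ∀ a p ρ : ℝ, |a - s| < ε → |p| < ε → |ρ - r| < ε →
      0 < t ^ 2 * a + ρ ^ 2 - 2 * t * p ∧ t ^ 2 * a + ρ ^ 2 - 2 * t * p < 1 ∧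
      |a + 1 + 2 * (-t * a + p) / √(t ^ 2 * a + ρ ^ 2 - 2 * t * p) - (1 + s - 2 * t * s)| < δ' := by
  set r0 := √(1 - t ^ 2 * s) with hr0
  have hpos : 0 < 1 - t ^ 2 * s := by nlinarith [sq_nonneg q]
  have hr0sq : r0 ^ 2 = 1 - t ^ 2 * s := Real.sq_sqrt hpos.le
  have hqr : q < r0 := Real.lt_sqrt_of_sq_lt hq2
  let N : ℝ × ℝ × ℝ → ℝ := fun v => t ^ 2 * v.1 + v.2.2 ^ 2 - 2 * t * v.2.1
  have hN : Continuous N := by fun_prop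
  let g : ℝ × ℝ × ℝ → ℝ := fun v => |v.1 + 1 + 2 * (-t * v.1 + v.2.1) / √(N v) - (1 + s - 2 * t * s)|
  have hN1 : N (s, 0, r0) = 1 := by simp only [N]; rw [hr0sq]; ring
  have hg : ContinuousAt g (s, 0, r0) := by
    apply ContinuousAt.abs
    apply ContinuousAt.sub _ continuousAt_const
    apply ContinuousAt.add (by fun_prop)
    apply ContinuousAt.div (by fun_prop) (by fun_prop)
    rw [hN1]; simp
  have hg0 : g (s, 0, r0) = 0 := by
    simp only [g]; rw [hN1]; simp; ring
  have hev : ∀ᶠ v in nhds (s, (0 : ℝ), r0), g v < δ' :=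
    hg.eventually (gt_mem_nhds (by rw [hg0]; exact hδ'))
  have hev2 := hev.eventually_nhds
  have htend : Tendsto (fun r : ℝ => (s, (0 : ℝ), r)) (nhdsWithin r0 (Set.Iio r0))
      (nhds (s, (0 : ℝ), r0)) := by
    have : Continuous (fun r : ℝ => (s, (0 : ℝ), r)) := by fun_prop
    exact (this.tendsto r0).mono_left nhdsWithin_le_nhds
  obtain ⟨r, hr, hqr1, hrr0⟩ := ((htend.eventually hev2).and (Ioo_mem_nhdsLT hqr)).exists
  have hr0' : 0 < r := hq.trans hqr1
  have hNr : N (s, 0, r) = t ^ 2 * s + r ^ 2 := by simp [N]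
  have hrsq : r ^ 2 < r0 ^ 2 := by gcongr
  have hNlt : N (s, 0, r) < 1 := by rw [hNr]; linarith
  have hNpos : ∀ᶠ v in nhds (s, (0 : ℝ), r), N v < 1 := hN.continuousAt.eventually (gt_mem_nhds hNlt)
  have hts : 0 < t ^ 2 * s + r ^ 2 := by positivity
  · have hN0 : ∀ᶠ v in nhds (s, (0 : ℝ), r), 0 < N v :=
      hN.continuousAt.eventually (lt_mem_nhds (by rw [hNr]; exact hts))
    obtain ⟨ε, hε, H⟩ := Metric.eventually_nhds_iff.1 (hN0.and (hNpos.and hr))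
    refine ⟨r, ε, hqr1, hε, fun a p ρ h1 h2 h3 => ?_⟩
    have := @H (a, p, ρ) (by
      rw [Prod.dist_eq, Prod.dist_eq]
      simp only [Real.dist_eq, sub_zero]
      exact max_lt h1 (max_lt h2 h3))
    exact this

open scoped Pointwise in
lemma step_lower {s t q δ' : ℝ} (hs : 0 ≤ s) (hq : 0 < q) (hq2 : q ^ 2 < 1 - t ^ 2 * s)
    (hδ' : 0 < δ') : ∃ δ : ℝ, 0 < δ ∧ ∀ᶠ d : ℕ in atTop, ∀ u : EE d, |‖u‖ ^ 2 - s| < δ →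
      ENNReal.ofReal (q ^ d) ≤ sphereUniform d
        {x | |‖u + (x : EE d)‖ ^ 2 - (1 + s - 2 * t * s)| < δ'} := by
  obtain ⟨r, ε, hqr, hε, H⟩ := step_params hs hq hq2 hδ'
  have hr : 0 < r := hq.trans hqr
  set M := s + 1 with hM
  have hM0 : 0 < M := by linarith
  set r1 := max (r - ε / 2) q with hr1
  have hr1r : r1 < r := max_lt (by linarith) hqr
  have hr10 : 0 < r1 := hq.trans_le (le_max_right _ _)
  set r2 := √(r ^ 2 - ε ^ 2 / M) with hr2
  have hr2r : r2 < r := by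
    rw [hr2, Real.sqrt_lt' hr]
    have : 0 < ε ^ 2 / M := by positivity
    linarith
  refine ⟨min ε 1, by positivity, ?_⟩
  filter_upwards [pow_small hq.le hqr, pow_small hr10.le hr1r, pow_small (Real.sqrt_nonneg _) hr2r,
    eventually_gt_atTop 0] with d p1 p2 p3 hd u hu
  have : Nonempty (Fin d) := ⟨⟨0, hd⟩⟩
  have huε : |‖u‖ ^ 2 - s| < ε := hu.trans_le (min_le_left _ _)
  have huM : ‖u‖ ^ 2 ≤ M := by
    have := (abs_lt.1 (hu.trans_le (min_le_right _ _))).2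
    linarith
  set A : Set (Metric.sphere (0 : EE d) 1) :=
    {x | |‖u + (x : EE d)‖ ^ 2 - (1 + s - 2 * t * s)| < δ'} with hA
  have hAm : MeasurableSet A := by
    apply measurableSet_lt <;> fun_prop
  rw [sphereUniform_apply hd hAm,
    ENNReal.le_div_iff_mul_le (by left; exact om_ne_zero d) (by left; exact om_ne_top d)]
  set Z : Set (EE d) := {z | ‖z‖ < r ∧ r1 ≤ ‖z‖ ∧ |inner ℝ u z| < ε} with hZ
  have hsub : Z ⊆ (fun z => (-t) • u + z) ⁻¹'
      (Set.Ioo (0 : ℝ) 1 • ((↑) '' A : Set (EE d))) := by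
    rintro z ⟨h1, h2, h3⟩
    have h2' : r - ε / 2 ≤ ‖z‖ := (le_max_left _ _).trans h2
    obtain ⟨k1, k2, k3⟩ := H (‖u‖ ^ 2) (inner ℝ u z) ‖z‖ huε h3 (by
      rw [abs_lt]; constructor <;> linarith)
    set y := (-t) • u + z with hy
    have hyn : ‖y‖ ^ 2 = t ^ 2 * ‖u‖ ^ 2 + ‖z‖ ^ 2 - 2 * t * inner ℝ u z := by
      rw [hy, norm_add_sq_real, norm_smul, real_inner_smul_left, mul_pow, Real.norm_eq_abs, sq_abs]
      ring
    rw [← hyn] at k1 k2 k3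
    rw [Real.sqrt_sq (norm_nonneg _)] at k3
    have hy0 : 0 < ‖y‖ := by
      rcases (norm_nonneg y).eq_or_lt with h | h
      · rw [← h] at k1; norm_num at k1
      · exact h
    have hy1 : ‖y‖ < 1 := by nlinarith
    rw [Set.mem_preimage, Set.mem_smul]
    refine ⟨‖y‖, ⟨hy0, hy1⟩, ‖y‖⁻¹ • y, ⟨⟨‖y‖⁻¹ • y, ?_⟩, ?_, rfl⟩, ?_⟩
    · simp [norm_smul, hy0.ne']
    · rw [hA, Set.mem_ofPred_eq]
      have e : ‖u + ‖y‖⁻¹ • y‖ ^ 2 = ‖u‖ ^ 2 + 1 + 2 * (-t * ‖u‖ ^ 2 + inner ℝ u z) / ‖y‖ := by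
        rw [norm_add_sq_real, norm_smul, real_inner_smul_right, norm_inv, norm_norm,
          inv_mul_cancel₀ hy0.ne', hy, inner_add_right, real_inner_smul_right,
          real_inner_self_eq_norm_sq]
        ring
      simp only [e]
      exact k3
    · rw [smul_smul, mul_inv_cancel₀ hy0.ne', one_smul]
  have hvZ : volume Z ≤ volume (Set.Ioo (0 : ℝ) 1 • ((↑) '' A : Set (EE d))) := by
    refine (measure_mono hsub).trans (le_of_eq ?_)
    rw [measure_preimage_add]
  refine le_trans ?_ hvZ
  have hcov : Metric.ball (0 : EE d) r ⊆ Z ∪ (Metric.ball 0 r1 ∪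
      ({z : EE d | ‖z‖ < r ∧ ε ≤ inner ℝ u z} ∪ {z : EE d | ‖z‖ < r ∧ ε ≤ inner ℝ (-u) z})) := by
    intro z hz
    rw [mem_ball_zero_iff] at hz
    simp only [Set.mem_union, hZ, Set.mem_ofPred_eq, mem_ball_zero_iff, inner_neg_left]
    by_cases c1 : ‖z‖ < r1
    · tauto
    · by_cases c2 : ε ≤ inner ℝ u z
      · tauto
      · by_cases c3 : ε ≤ -inner ℝ u z
        · tauto
        · left
          refine ⟨hz, not_lt.1 c1, abs_lt.2 ⟨by linarith, by linarith⟩⟩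
  have hb : ∀ ρ : ℝ, 0 < ρ → volume (Metric.ball (0 : EE d) ρ) = ENNReal.ofReal (ρ ^ d) * om d := by
    intro ρ hρ
    rw [Measure.addHaar_ball_of_pos _ _ hρ]; simp [om]
  have hm := measure_mono (μ := volume) hcov
  rw [hb r hr] at hm
  have hm2 : ENNReal.ofReal (r ^ d) * om d ≤ volume Z +
      ENNReal.ofReal (r1 ^ d + 2 * r2 ^ d) * om d := by
    refine hm.trans ((measure_union_le _ _).trans ?_)
    gcongr
    refine (measure_union_le _ _).trans ?_
    rw [ENNReal.ofReal_add (by positivity) (by positivity), add_mul, hb r1 hr10]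
    gcongr
    refine (measure_union_le _ _).trans ?_
    rw [two_mul, ENNReal.ofReal_add (by positivity) (by positivity), add_mul]
    gcongr
    · exact vol_slab hd u hM0 huM hε
    · exact vol_slab hd (-u) hM0 (by rwa [norm_neg]) hε
  have hfin : ENNReal.ofReal (r1 ^ d + 2 * r2 ^ d) * om d ≠ ⊤ :=
    ENNReal.mul_ne_top ENNReal.ofReal_ne_top (om_ne_top d)
  rw [← ENNReal.add_le_add_iff_right hfin]
  refine le_trans ?_ hm2
  rw [← add_mul, ← ENNReal.ofReal_add (by positivity) (by positivity)]
  gcongr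
  linarith

noncomputable def goodInd (d : ℕ) : EE d → ENNReal :=
  Set.indicator {u : EE d | ‖u‖ ≤ 1} (fun _ => 1)

lemma goodInd_measurable (d : ℕ) : Measurable (goodInd d) := by
  apply Measurable.indicator measurable_const
  apply measurableSet_le <;> fun_prop

lemma JJ_lower {k : ℕ} (hk : 2 ≤ k) (n : ℕ) : n + 1 ≤ k → ∀ q : ℝ, 0 < q →
    q ^ 2 < (((k : ℝ) + 1) / k) ^ (n + 1) / ((n : ℝ) + 2) →
    ∃ δ : ℝ, 0 < δ ∧ ∀ᶠ d : ℕ in atTop, ∀ u : EE d,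
      |‖u‖ ^ 2 - ((k : ℝ) - (n + 1)) * (n + 2) / k| < δ →
      ENNReal.ofReal (q ^ d) ≤ JJ d (n + 1) (goodInd d) u := by
  have hk2 : (2 : ℝ) ≤ k := by exact_mod_cast hk
  have hk0 : (0 : ℝ) < k := by linarith
  induction n with
  | zero =>
    intro _ q hq hq2
    set s : ℝ := ((k : ℝ) - ((0 : ℕ) + 1)) * ((0 : ℕ) + 2) / k with hs
    have hs0 : 0 < s := by
      rw [hs]; push_cast
      apply div_pos _ hk0
      nlinarith
    have hc : 1 - (1 / 2 + 0) ^ 2 * s = (((k : ℝ) + 1) / k) ^ (0 + 1) / (((0 : ℕ) : ℝ) + 2) := by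
      rw [hs]; push_cast; field_simp; ring
    have hcont : Continuous (fun τ : ℝ => 1 - (1 / 2 + τ) ^ 2 * s) := by fun_prop
    have hev : ∀ᶠ τ in nhdsWithin (0 : ℝ) (Set.Ioi 0), q ^ 2 < 1 - (1 / 2 + τ) ^ 2 * s :=
      (hcont.continuousAt.eventually (lt_mem_nhds (by
        change q ^ 2 < 1 - (1 / 2 + 0) ^ 2 * s
        rw [hc]; exact hq2))).filter_mono
        nhdsWithin_le_nhds
    obtain ⟨τ, hτ, hτ0⟩ := (hev.and self_mem_nhdsWithin).exists
    obtain ⟨δ, hδ, H⟩ := step_lower hs0.le hq hτ (δ' := 2 * τ * s) (by positivity)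
    refine ⟨δ, hδ, ?_⟩
    filter_upwards [H, eventually_gt_atTop 0] with d hd hd0 u hu
    rw [JJ_succ hd0 0 (goodInd_measurable d)]
    simp only [JJ_zero]
    refine (hd u hu).trans ?_
    have hm : MeasurableSet {x : Metric.sphere (0 : EE d) 1 |
        |‖u + (x : EE d)‖ ^ 2 - (1 + s - 2 * (1 / 2 + τ) * s)| < 2 * τ * s} := by
      apply measurableSet_lt <;> fun_prop
    rw [← lintegral_indicator_one hm]
    apply lintegral_mono
    intro x
    by_cases hx : x ∈ {x : Metric.sphere (0 : EE d) 1 |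
        |‖u + (x : EE d)‖ ^ 2 - (1 + s - 2 * (1 / 2 + τ) * s)| < 2 * τ * s}
    · rw [Set.indicator_of_mem hx]
      rw [Set.mem_ofPred_eq] at hx
      have h1 := (abs_lt.1 hx).2
      have h2 : ‖u + (x : EE d)‖ ≤ 1 := by
        by_contra hcon
        push Not at hcon
        nlinarith
      simp only [goodInd]
      rw [Set.indicator_of_mem (by exact h2)]
      simp
    · rw [Set.indicator_of_notMem hx]
      exact zero_le
  | succ n ih =>
    intro hn q hq hq2
    have hnk : (n : ℝ) + 2 ≤ k := by exact_mod_cast (by omega : n + 2 ≤ k)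
    set R : ℝ := (((k : ℝ) + 1) / k) ^ (n + 1) / ((n : ℝ) + 2) with hR
    have hR0 : 0 < R := by positivity
    set ρ : ℝ := ((k : ℝ) + 1) * (n + 2) / (k * (n + 3)) with hρ
    have hRρ : (((k : ℝ) + 1) / k) ^ (n + 1 + 1) / (((n + 1 : ℕ) : ℝ) + 2) = R * ρ := by
      rw [hR, hρ, pow_succ]; push_cast; field_simp; ring
    rw [hRρ] at hq2
    obtain ⟨m, hm1, hm2⟩ := exists_between ((div_lt_iff₀' hR0).2 hq2)
    have hm0 : 0 < m := lt_trans (by positivity) hm1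
    set q2 := √m with hq2d
    have hq20 : 0 < q2 := Real.sqrt_pos.2 hm0
    have hq2s : q2 ^ 2 = m := Real.sq_sqrt hm0.le
    obtain ⟨δ', hδ', H1⟩ := ih (by omega) (q / q2) (by positivity) (by
      rw [div_pow, hq2s]
      rw [div_lt_iff₀ hm0]
      rwa [div_lt_iff₀' hR0] at hm1)
    set s : ℝ := ((k : ℝ) - ((n + 1 : ℕ) + 1)) * ((n + 1 : ℕ) + 2) / k with hs
    have hs0 : 0 ≤ s := by
      rw [hs]; push_cast
      apply div_nonneg _ hk0.le
      apply mul_nonneg <;> linarith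
    have hts : 1 - (1 / ((n : ℝ) + 3)) ^ 2 * s = ρ := by
      rw [hs, hρ]; push_cast; field_simp; ring
    have htarget : 1 + s - 2 * (1 / ((n : ℝ) + 3)) * s = ((k : ℝ) - (n + 1)) * (n + 2) / k := by
      rw [hs]; push_cast; field_simp; ring
    obtain ⟨δ, hδ, H2⟩ := step_lower hs0 hq20 (t := 1 / ((n : ℝ) + 3))
      (by rw [hts, hq2s]; exact hm2) hδ'
    refine ⟨δ, hδ, ?_⟩
    filter_upwards [H1, H2, eventually_gt_atTop 0] with d h1 h2 hd0 u hu
    rw [JJ_succ hd0 (n + 1) (goodInd_measurable d)]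
    have h3 := h2 u hu
    rw [htarget] at h3
    set A := {x : Metric.sphere (0 : EE d) 1 |
        |‖u + (x : EE d)‖ ^ 2 - ((k : ℝ) - (n + 1)) * (n + 2) / k| < δ'} with hA
    have hm : MeasurableSet A := by
      apply measurableSet_lt <;> fun_prop
    calc ENNReal.ofReal (q ^ d) = ENNReal.ofReal ((q / q2) ^ d) * ENNReal.ofReal (q2 ^ d) := by
          rw [← ENNReal.ofReal_mul (by positivity), ← mul_pow, div_mul_cancel₀ _ hq20.ne']
      _ ≤ ENNReal.ofReal ((q / q2) ^ d) * sphereUniform d A := by gcongr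
      _ = ∫⁻ x in A, ENNReal.ofReal ((q / q2) ^ d) ∂(sphereUniform d) := by
          rw [setLIntegral_const]
      _ ≤ ∫⁻ x in A, JJ d (n + 1) (goodInd d) (u + (x : EE d)) ∂(sphereUniform d) := by
          apply setLIntegral_mono' hm
          intro x hx
          exact h1 _ hx
      _ ≤ _ := setLIntegral_le_lintegral _ _

lemma JJ_ne_top {d : ℕ} (hd : 0 < d) (k : ℕ) (u : EE d) : JJ d k (goodInd d) u ≠ ⊤ := by
  have := sphereUniform_isProb hd
  refine ne_top_of_le_ne_top (b := 1) (by simp) ?_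
  unfold JJ
  calc _ ≤ ∫⁻ x : Fin k → Metric.sphere (0 : EE d) 1, 1
        ∂(Measure.pi fun _ : Fin k => sphereUniform d) := by
        apply lintegral_mono
        intro x
        exact Set.indicator_le_self' (fun _ _ => zero_le) _
    _ = 1 := by simp

lemma prob_lower {k : ℕ} (hk : 2 ≤ k) {q : ℝ} (hq : 0 < q) (hq2 : q ^ 2 < QQ k) :
    ∀ᶠ d : ℕ in atTop, q ^ d ≤ goodTupleProb k d := by
  obtain ⟨n, rfl⟩ : ∃ n, k = n + 1 := ⟨k - 1, by omega⟩
  have e : (((n + 1 : ℕ) : ℝ) + 1) = (n : ℝ) + 2 := by push_cast; ring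
  obtain ⟨δ, hδ, H⟩ := JJ_lower hk n le_rfl q hq (by
    refine hq2.trans_eq ?_
    rw [QQ, e, Nat.add_sub_cancel, div_pow]
    push_cast
    field_simp
    ring)
  filter_upwards [H, eventually_gt_atTop 0] with d hd hd0
  rw [goodTupleProb_eq]
  rw [← ENNReal.ofReal_le_iff_le_toReal]
  · apply hd 0
    push_cast
    simpa using hδ
  · exact JJ_ne_top hd0 _ _

lemma upper_tendsto (C : ℝ) (hC : 0 < C) (k : ℕ) (L : ℝ) :
    Tendsto (fun d : ℕ => (2 / (d : ℝ)) * (k * Real.log (C * ((d : ℝ) / 2 + 1))) + L) atTop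
      (nhds L) := by
  have h1 : Tendsto (fun d : ℕ => C * ((d : ℝ) / 2 + 1)) atTop atTop := by
    apply Tendsto.const_mul_atTop hC
    apply tendsto_atTop_add_const_right
    exact tendsto_natCast_atTop_atTop.atTop_div_const (by norm_num)
  have h2 : Tendsto (fun x : ℝ => Real.log x / x) atTop (nhds 0) := by
    simpa using Real.isLittleO_log_id_atTop.tendsto_div_nhds_zero
  have h3 := h2.comp h1
  have h4 : Tendsto (fun d : ℕ => C * (1 + 2 / (d : ℝ))) atTop (nhds (C * (1 + 0))) :=
    (tendsto_const_nhds.add (tendsto_const_div_atTop_nhds_zero_nat 2)).const_mul C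
  have h5 := ((h3.mul h4).const_mul (k : ℝ)).add_const L
  rw [zero_mul, mul_zero, zero_add] at h5
  refine h5.congr' ?_
  filter_upwards [eventually_gt_atTop 0] with d hd
  have hd' : (0 : ℝ) < d := by exact_mod_cast hd
  simp only [Function.comp]
  field_simp

theorem good_tuple_probability_asymptotics (k : ℕ) (hk : 2 ≤ k) :
    Tendsto (fun d : ℕ => (2 / (d : ℝ)) * Real.log (goodTupleProb k d)) atTop
      (nhds (((k : ℝ) - 1) * Real.log ((k : ℝ) + 1) - (k : ℝ) * Real.log (k : ℝ))) := by
  have hk0 : (0 : ℝ) < k := by exact_mod_cast (by omega : 0 < k)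
  have hQ := QQ_pos hk
  have hL : ((k : ℝ) - 1) * Real.log ((k : ℝ) + 1) - (k : ℝ) * Real.log (k : ℝ) =
      Real.log (QQ k) := by
    rw [QQ, Real.log_div (by positivity) (by positivity), Real.log_pow, Real.log_pow,
      Nat.cast_sub (by omega), Nat.cast_one]
  rw [hL]
  set L := Real.log (QQ k) with hLd
  have hlow : ∀ a < L, ∀ᶠ d : ℕ in atTop, 0 < goodTupleProb k d ∧
      a ≤ (2 / (d : ℝ)) * Real.log (goodTupleProb k d) := by
    intro a ha
    have hq2 : Real.exp (a / 2) ^ 2 < QQ k := by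
      rw [← Real.exp_nat_mul, ← Real.exp_log hQ, Real.exp_lt_exp]
      push_cast
      linarith
    filter_upwards [prob_lower hk (Real.exp_pos (a / 2)) hq2, eventually_gt_atTop 0] with d hd hd0
    have hd' : (0 : ℝ) < d := by exact_mod_cast hd0
    have hpos : 0 < goodTupleProb k d := lt_of_lt_of_le (by positivity) hd
    refine ⟨hpos, ?_⟩
    have h := Real.log_le_log (by positivity) hd
    rw [Real.log_pow, Real.log_exp] at h
    calc a = 2 / (d : ℝ) * (d * (a / 2)) := by field_simp
      _ ≤ _ := by gcongr
  obtain ⟨C, hC, hup⟩ := prob_upper hk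
  rw [tendsto_order]
  constructor
  · intro a ha
    obtain ⟨b, hab, hb⟩ := exists_between ha
    filter_upwards [hlow b hb] with d hd
    linarith [hd.2]
  · intro a ha
    filter_upwards [(upper_tendsto C hC k L).eventually (gt_mem_nhds ha), hlow (L - 1) (by linarith),
      eventually_ge_atTop 2] with d h1 h2 h3
    have hd' : (0 : ℝ) < d := by exact_mod_cast (by omega : 0 < d)
    refine lt_of_le_of_lt ?_ h1
    have h := Real.log_le_log h2.1 (hup d h3)
    rw [Real.log_mul (by positivity) (by positivity), Real.log_pow, Real.log_rpow hQ] at h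
    calc _ ≤ 2 / (d : ℝ) * (k * Real.log (C * ((d : ℝ) / 2 + 1)) + d / 2 * L) := by gcongr
      _ = _ := by field_simp
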